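/- arXiv:math-ph/0001041 — 2 statements merged into one kernel-verified Lean document; each statement's English description precedes it below -/
import Mathlib

section
/- Let q ∈ ℂ be a primitive cube root of unity and let Ω_q be the quotient of the free associative unital ℂ-algebra on three generators X, Y, Z (representing x, dx, d²x of degrees 0, 1, 2 respectively) by the two-sided ideal generated by the elements X³, YX − qXY, ZX − qXZ, Y³, and ZY − q²YZ. Since the defining relations are homogeneous, Ω_q carries the induced ℕ-grading. Then there exists a ℂ-linear map d : Ω_q → Ω_q such that d(1) = 0, d(x̄) = ȳ, d(ȳ) = z̄, d(z̄) = 0 (where x̄, ȳ, z̄ are the images of X, Y, Z), d satisfies the graded q-Leibniz rule d(uv) = d(u)·v + q^a·u·d(v) for every homogeneous u of degree a and every v, and d³ = 0; i.e. Ω_q is a graded q-differential algebra. -/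
/-- Generator `X` (representing the coordinate `x`, degree 0). -/
noncomputable def genX : FreeAlgebra ℂ (Fin 3) := FreeAlgebra.ι ℂ 0
/-- Generator `Y` (representing `dx`, degree 1). -/
noncomputable def genY : FreeAlgebra ℂ (Fin 3) := FreeAlgebra.ι ℂ 1
/-- Generator `Z` (representing `d²x`, degree 2). -/
noncomputable def genZ : FreeAlgebra ℂ (Fin 3) := FreeAlgebra.ι ℂ 2

/-- The defining relations of the algebra of differential forms on the anyonic line:
`X³ = 0`, `YX = qXY`, `ZX = qXZ`, `Y³ = 0`, `ZY = q²YZ`. -/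
inductive OmegaRel (q : ℂ) : FreeAlgebra ℂ (Fin 3) → FreeAlgebra ℂ (Fin 3) → Prop
  | x3 : OmegaRel q (genX ^ 3) 0
  | yx : OmegaRel q (genY * genX) (q • (genX * genY))
  | zx : OmegaRel q (genZ * genX) (q • (genX * genZ))
  | y3 : OmegaRel q (genY ^ 3) 0
  | zy : OmegaRel q (genZ * genY) (q ^ 2 • (genY * genZ))

/-- `Ω_q`: the quotient of the free algebra `ℂ⟨X, Y, Z⟩` by the two-sided ideal generated
by the relations above. -/
abbrev OmegaAlg (q : ℂ) := RingQuot (OmegaRel q)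

/-- The canonical projection `ℂ⟨X, Y, Z⟩ → Ω_q`. -/
noncomputable def omegaMk (q : ℂ) : FreeAlgebra ℂ (Fin 3) →ₐ[ℂ] OmegaAlg q :=
  RingQuot.mkAlgHom ℂ (OmegaRel q)

/-- The degrees of the generators `X, Y, Z` (`x, dx, d²x`). -/
def genDeg : Fin 3 → ℕ := ![0, 1, 2]

/-- The set of (images of) monomials of total degree `n` in `Ω_q`; a general homogeneous
element of degree `n` is a ℂ-linear combination of these. -/
def degMonomials (q : ℂ) (n : ℕ) : Set (OmegaAlg q) :=
  { u | ∃ l : List (Fin 3), (l.map genDeg).sum = n ∧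
        u = omegaMk q (l.map (FreeAlgebra.ι ℂ)).prod }

/-- The matrices `!![σ u, d u; 0, u]` attached to the generators `u = x̄, ȳ, z̄`, where `σ` is the
grading twist. An algebra map of this shape encodes a twisted derivation `d`. -/
noncomputable def twistedMatrix (q : ℂ) : Fin 3 → Matrix (Fin 2) (Fin 2) (OmegaAlg q) :=
  ![!![omegaMk q genX, omegaMk q genY; 0, omegaMk q genX],
    !![q • omegaMk q genY, omegaMk q genZ; 0, omegaMk q genY],
    !![q ^ 2 • omegaMk q genZ, 0; 0, omegaMk q genZ]]

theorem sq_add_self_add_one_eq_zero {q : ℂ} (hq3 : q ^ 3 = 1) (hq1 : q ≠ 1) :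
    q ^ 2 + q + 1 = 0 := by
  have : (q - 1) * (q ^ 2 + q + 1) = 0 := by linear_combination hq3
  exact (mul_eq_zero.mp this).resolve_left (sub_ne_zero.mpr hq1)

theorem omegaMk_rel {q : ℂ} {a b : FreeAlgebra ℂ (Fin 3)} (h : OmegaRel q a b) :
    omegaMk q a = omegaMk q b :=
  RingQuot.mkAlgHom_rel ℂ h

theorem twistedMatrix_respects {q : ℂ} (hq3 : q ^ 3 = 1) (hq1 : q ≠ 1)
    {a b : FreeAlgebra ℂ (Fin 3)} (h : OmegaRel q a b) :
    FreeAlgebra.lift ℂ (twistedMatrix q) a = FreeAlgebra.lift ℂ (twistedMatrix q) b := by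
  have hsum := sq_add_self_add_one_eq_zero hq3 hq1
  have hX := omegaMk_rel (OmegaRel.x3 (q := q))
  have hYX := omegaMk_rel (OmegaRel.yx (q := q))
  have hZX := omegaMk_rel (OmegaRel.zx (q := q))
  have hY := omegaMk_rel (OmegaRel.y3 (q := q))
  have hZY := omegaMk_rel (OmegaRel.zy (q := q))
  have gX : FreeAlgebra.lift ℂ (twistedMatrix q) genX = twistedMatrix q 0 :=
    FreeAlgebra.lift_ι_apply _ _
  have gY : FreeAlgebra.lift ℂ (twistedMatrix q) genY = twistedMatrix q 1 :=
    FreeAlgebra.lift_ι_apply _ _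
  have gZ : FreeAlgebra.lift ℂ (twistedMatrix q) genZ = twistedMatrix q 2 :=
    FreeAlgebra.lift_ι_apply _ _
  simp only [map_mul, map_smul, map_pow, map_zero] at hX hYX hZX hY hZY
  have q4 : q ^ 4 = q := by linear_combination q * hq3
  cases h <;> simp only [map_mul, map_smul, map_pow, map_zero, gX, gY, gZ]
  all_goals
    simp only [twistedMatrix, Matrix.cons_val]
    generalize omegaMk q genX = x at *
    generalize omegaMk q genY = y at *
    generalize omegaMk q genZ = z at *
    rw [← Matrix.ext_iff]
    simp only [Fin.forall_fin_two, pow_three, Matrix.mul_fin_two, Matrix.smul_apply,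
      Matrix.of_apply, Matrix.cons_val', Matrix.cons_val, Matrix.zero_apply, mul_zero, zero_mul,
      add_zero, zero_add, smul_zero, true_and]
    simp only [pow_three] at hX hY
  · refine ⟨⟨hX, ?_⟩, hX⟩
    rw [hYX, mul_add, mul_smul_comm, ← mul_assoc y, hYX, smul_mul_assoc, mul_assoc, hYX,
      mul_smul_comm, smul_smul]
    linear_combination (norm := module) hsum • (x * (x * y))
  · refine ⟨⟨?_, ?_⟩, hYX⟩
    · rw [smul_mul_assoc, hYX, mul_smul_comm]
    · rw [hZX, smul_mul_assoc, smul_add, add_comm]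
  · refine ⟨⟨?_, ?_⟩, hZX⟩
    · rw [smul_mul_assoc, hZX, mul_smul_comm, smul_comm]
    · rw [smul_mul_assoc, hZY, smul_smul, ← pow_add, q4]
  · refine ⟨⟨?_, ?_⟩, hY⟩
    · simp only [smul_mul_assoc, mul_smul_comm, hY, smul_zero]
    · simp only [smul_mul_assoc, mul_smul_comm, mul_add, hZY, smul_smul, ← mul_assoc z]
      simp only [mul_assoc, hZY, mul_smul_comm, smul_smul]
      have : q * (q * 1) + q * q ^ 2 + q ^ 2 * q ^ 2 = 0 := by
        linear_combination hsum + q4 + hq3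
      linear_combination (norm := module) this • (y * (y * z))
  · refine ⟨⟨?_, ?_⟩, hZY⟩
    · simp only [smul_mul_assoc, mul_smul_comm, hZY, smul_smul]
      congr 1; ring
    · rw [smul_mul_assoc]

/-- The algebra map `u ↦ !![σ u, d u; 0, u]`. -/
noncomputable def twistedHom {q : ℂ} (hq3 : q ^ 3 = 1) (hq1 : q ≠ 1) :
    OmegaAlg q →ₐ[ℂ] Matrix (Fin 2) (Fin 2) (OmegaAlg q) :=
  RingQuot.liftAlgHom ℂ
    ⟨FreeAlgebra.lift ℂ (twistedMatrix q), fun _ _ h => twistedMatrix_respects hq3 hq1 h⟩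

section

variable {q : ℂ} (hq3 : q ^ 3 = 1) (hq1 : q ≠ 1)

theorem twistedHom_mk_ι (i : Fin 3) :
    twistedHom hq3 hq1 (omegaMk q (FreeAlgebra.ι ℂ i)) = twistedMatrix q i := by
  rw [twistedHom, omegaMk, RingQuot.liftAlgHom_mkAlgHom_apply, FreeAlgebra.lift_ι_apply]

theorem twistedHom_lower (u : OmegaAlg q) :
    twistedHom hq3 hq1 u 1 0 = 0 ∧ twistedHom hq3 hq1 u 1 1 = u := by
  obtain ⟨p, rfl⟩ := RingQuot.mkAlgHom_surjective ℂ (OmegaRel q) u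
  change twistedHom hq3 hq1 (omegaMk q p) 1 0 = 0 ∧
    twistedHom hq3 hq1 (omegaMk q p) 1 1 = omegaMk q p
  induction p using FreeAlgebra.induction with
  | grade0 r => simp [Matrix.algebraMap_matrix_apply]
  | grade1 i =>
    rw [twistedHom_mk_ι]
    fin_cases i <;> simp [twistedMatrix, genX, genY, genZ]
  | mul a b ha hb => simp [Matrix.mul_apply, ha, hb]
  | add a b ha hb => simp [ha, hb]

/-- The differential of `Ω_q`. -/
noncomputable def omegaDiff : OmegaAlg q →ₗ[ℂ] OmegaAlg q :=
  Matrix.entryLinearMap ℂ (OmegaAlg q) 0 1 ∘ₗ (twistedHom hq3 hq1).toLinearMap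

theorem omegaDiff_apply (u : OmegaAlg q) :
    omegaDiff hq3 hq1 u = twistedHom hq3 hq1 u 0 1 := rfl

theorem omegaDiff_mk_ι (i : Fin 3) :
    omegaDiff hq3 hq1 (omegaMk q (FreeAlgebra.ι ℂ i)) = twistedMatrix q i 0 1 := by
  rw [omegaDiff_apply, twistedHom_mk_ι]

theorem omegaDiff_one : omegaDiff hq3 hq1 1 = 0 := by simp [omegaDiff_apply]

theorem omegaDiff_genX : omegaDiff hq3 hq1 (omegaMk q genX) = omegaMk q genY :=
  omegaDiff_mk_ι hq3 hq1 0

theorem omegaDiff_genY : omegaDiff hq3 hq1 (omegaMk q genY) = omegaMk q genZ :=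
  omegaDiff_mk_ι hq3 hq1 1

theorem omegaDiff_genZ : omegaDiff hq3 hq1 (omegaMk q genZ) = 0 :=
  omegaDiff_mk_ι hq3 hq1 2

theorem twistedHom_upper_left {n : ℕ} {u : OmegaAlg q}
    (hu : u ∈ Submodule.span ℂ (degMonomials q n)) :
    twistedHom hq3 hq1 u 0 0 = q ^ n • u := by
  induction hu using Submodule.span_induction with
  | mem u hu =>
    obtain ⟨l, rfl, rfl⟩ := hu
    induction l with
    | nil => simp
    | cons i l ih =>
      have hi : twistedMatrix q i 0 0 = q ^ genDeg i • omegaMk q (FreeAlgebra.ι ℂ i) := by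
        fin_cases i <;> simp [twistedMatrix, genDeg, genX, genY, genZ]
      simp [Matrix.mul_apply, twistedHom_mk_ι, ih, hi,
        (twistedHom_lower hq3 hq1 _).1, pow_add, smul_smul, mul_comm]
  | zero => simp
  | add u v _ _ hu hv => simp [hu, hv]
  | smul c u _ hu => simp [hu, smul_comm c]

theorem omegaDiff_mul {n : ℕ} {u : OmegaAlg q}
    (hu : u ∈ Submodule.span ℂ (degMonomials q n)) (v : OmegaAlg q) :
    omegaDiff hq3 hq1 (u * v) =
      omegaDiff hq3 hq1 u * v + q ^ n • (u * omegaDiff hq3 hq1 v) := by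
  simp only [omegaDiff_apply, map_mul, Matrix.mul_apply, Fin.sum_univ_two,
    twistedHom_upper_left hq3 hq1 hu, (twistedHom_lower hq3 hq1 v).2, smul_mul_assoc]
  exact add_comm _ _

theorem mk_ι_mem (i : Fin 3) :
    omegaMk q (FreeAlgebra.ι ℂ i) ∈ Submodule.span ℂ (degMonomials q (genDeg i)) :=
  Submodule.subset_span ⟨[i], by simp, by simp⟩

theorem mul_mem_span_degMonomials {m n : ℕ} {u v : OmegaAlg q}
    (hu : u ∈ Submodule.span ℂ (degMonomials q m))
    (hv : v ∈ Submodule.span ℂ (degMonomials q n)) :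
    u * v ∈ Submodule.span ℂ (degMonomials q (m + n)) := by
  have h := Submodule.mul_mem_mul hu hv
  rw [Submodule.span_mul_span] at h
  refine Submodule.span_mono ?_ h
  rintro _ ⟨_, ⟨k, rfl, rfl⟩, _, ⟨l, rfl, rfl⟩, rfl⟩
  exact ⟨k ++ l, by simp, by simp⟩

theorem omegaDiff_mk_ι_mem (i : Fin 3) :
    omegaDiff hq3 hq1 (omegaMk q (FreeAlgebra.ι ℂ i)) ∈
      Submodule.span ℂ (degMonomials q (genDeg i + 1)) := by
  rw [omegaDiff_mk_ι]
  fin_cases i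
  · exact mk_ι_mem 1
  · exact mk_ι_mem 2
  · exact Submodule.zero_mem _

theorem omegaDiff_mem {n : ℕ} {u : OmegaAlg q}
    (hu : u ∈ Submodule.span ℂ (degMonomials q n)) :
    omegaDiff hq3 hq1 u ∈ Submodule.span ℂ (degMonomials q (n + 1)) := by
  induction hu using Submodule.span_induction with
  | mem u hu =>
    obtain ⟨l, rfl, rfl⟩ := hu
    induction l with
    | nil => simp [omegaDiff_one]
    | cons i l ih =>
      simp only [List.map_cons, List.prod_cons, List.sum_cons]
      rw [map_mul, omegaDiff_mul hq3 hq1 (mk_ι_mem i)]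
      refine add_mem ?_ (Submodule.smul_mem _ _ ?_)
      · rw [add_right_comm]
        exact mul_mem_span_degMonomials (omegaDiff_mk_ι_mem hq3 hq1 i)
          (Submodule.subset_span ⟨l, rfl, rfl⟩)
      · rw [add_assoc]
        exact mul_mem_span_degMonomials (mk_ι_mem i) ih
  | zero => simp
  | add u v _ _ hu hv => rw [map_add]; exact add_mem hu hv
  | smul c u _ hu => rw [map_smul]; exact Submodule.smul_mem _ _ hu

theorem omegaDiff_cube_mul {n : ℕ} {u : OmegaAlg q}
    (hu : u ∈ Submodule.span ℂ (degMonomials q n)) (v : OmegaAlg q) :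
    omegaDiff hq3 hq1 (omegaDiff hq3 hq1 (omegaDiff hq3 hq1 (u * v))) =
      omegaDiff hq3 hq1 (omegaDiff hq3 hq1 (omegaDiff hq3 hq1 u)) * v +
        u * omegaDiff hq3 hq1 (omegaDiff hq3 hq1 (omegaDiff hq3 hq1 v)) := by
  have hsum := sq_add_self_add_one_eq_zero hq3 hq1
  have hn : q ^ n * (q ^ n * q ^ n) = 1 := by
    rw [← pow_three, ← pow_mul, mul_comm n, pow_mul, hq3, one_pow]
  have hu' := omegaDiff_mem hq3 hq1 hu
  have hu'' := omegaDiff_mem hq3 hq1 hu'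
  simp only [omegaDiff_mul hq3 hq1 hu, omegaDiff_mul hq3 hq1 hu', omegaDiff_mul hq3 hq1 hu'',
    map_add, map_smul, smul_add, smul_smul]
  generalize omegaDiff hq3 hq1 u = u', omegaDiff hq3 hq1 v = v'
  generalize omegaDiff hq3 hq1 u' = u'', omegaDiff hq3 hq1 v' = v''
  generalize omegaDiff hq3 hq1 v'' = ω
  have h₁ : q ^ (n + 1 + 1) + q ^ (n + 1) + q ^ n = 0 := by linear_combination q ^ n * hsum
  have h₂ : q ^ (n + 1) * q ^ (n + 1) + q ^ n * q ^ (n + 1) + q ^ n * q ^ n = 0 := by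
    linear_combination q ^ n * q ^ n * hsum
  linear_combination (norm := module)
    h₁ • (u'' * v') + h₂ • (u' * v'') + hn • (u * ω)

theorem omegaDiff_cube (u : OmegaAlg q) :
    omegaDiff hq3 hq1 (omegaDiff hq3 hq1 (omegaDiff hq3 hq1 u)) = 0 := by
  obtain ⟨p, rfl⟩ := RingQuot.mkAlgHom_surjective ℂ (OmegaRel q) u
  change omegaDiff hq3 hq1 (omegaDiff hq3 hq1 (omegaDiff hq3 hq1 (omegaMk q p))) = 0
  suffices h : ∀ w : OmegaAlg q,
      omegaDiff hq3 hq1 (omegaDiff hq3 hq1 (omegaDiff hq3 hq1 w)) = 0 →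
      omegaDiff hq3 hq1 (omegaDiff hq3 hq1 (omegaDiff hq3 hq1 (omegaMk q p * w))) = 0 by
    simpa using h 1 (by simp [omegaDiff_one])
  induction p using FreeAlgebra.induction with
  | grade0 r =>
    intro w hw
    rw [AlgHom.commutes, ← Algebra.smul_def]
    simp [hw]
  | grade1 i =>
    intro w hw
    rw [omegaDiff_cube_mul hq3 hq1 (mk_ι_mem i), hw, mul_zero, add_zero]
    have : omegaDiff hq3 hq1 (omegaDiff hq3 hq1 (omegaDiff hq3 hq1
        (omegaMk q (FreeAlgebra.ι ℂ i)))) = 0 := by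
      rw [omegaDiff_mk_ι]
      fin_cases i <;> simp [twistedMatrix, omegaDiff_genY, omegaDiff_genZ]
    rw [this, zero_mul]
  | mul a b ha hb =>
    intro w hw
    rw [map_mul (omegaMk q), mul_assoc]
    exact ha _ (hb _ hw)
  | add a b ha hb =>
    intro w hw
    simp [add_mul, ha w hw, hb w hw]

end

/-- For `q` a primitive cube root of unity, `Ω_q` is a graded
`q`-differential algebra: there is a ℂ-linear map `d : Ω_q → Ω_q` of degree 1 with
`d 1 = 0`, `d x̄ = ȳ`, `d ȳ = z̄`, `d z̄ = 0`, satisfying the graded `q`-Leibniz rule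
`d (u v) = d u · v + q^a • (u · d v)` for homogeneous `u` of degree `a`, and `d³ = 0`. -/
theorem omega_is_graded_q_differential_algebra
    (q : ℂ) (hq3 : q ^ 3 = 1) (hq1 : q ≠ 1) :
    ∃ d : OmegaAlg q →ₗ[ℂ] OmegaAlg q,
      d 1 = 0 ∧
      d (omegaMk q genX) = omegaMk q genY ∧
      d (omegaMk q genY) = omegaMk q genZ ∧
      d (omegaMk q genZ) = 0 ∧
      (∀ a : ℕ, ∀ u ∈ Submodule.span ℂ (degMonomials q a),
        d u ∈ Submodule.span ℂ (degMonomials q (a + 1))) ∧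
      (∀ a : ℕ, ∀ u ∈ Submodule.span ℂ (degMonomials q a), ∀ v : OmegaAlg q,
        d (u * v) = d u * v + q ^ a • (u * d v)) ∧
      (∀ ω : OmegaAlg q, d (d (d ω)) = 0) := by
  exact ⟨omegaDiff hq3 hq1, omegaDiff_one hq3 hq1, omegaDiff_genX hq3 hq1, omegaDiff_genY hq3 hq1,
    omegaDiff_genZ hq3 hq1, fun _ _ hu => omegaDiff_mem hq3 hq1 hu,
    fun _ _ hu v => omegaDiff_mul hq3 hq1 hu v, omegaDiff_cube hq3 hq1⟩
end

section
/- Let q ∈ ℂ be a primitive cube root of unity and let Ω_q be the quotient of the free associative unital ℂ-algebra on three generators X, Y, Z by the two-sided ideal generated by X³, YX − qXY, ZX − qXZ, Y³, and ZY − q²YZ. Then the images of the monomials X^i Y^j Z^k with 0 ≤ i ≤ 2, 0 ≤ j ≤ 2, and k ∈ ℕ form a ℂ-vector space basis of Ω_q; in particular the relations are consistent (Ω_q ≠ 0) and Ω_q is a free left module over the subalgebra generated by x̄ ≅ ℂ[X]/(X³) on the monomials ȳ^j z̄^k, 0 ≤ j ≤ 2, k ∈ ℕ. -/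
/-- The family of monomials `x̄^i ȳ^j z̄^k`, `0 ≤ i ≤ 2`, `0 ≤ j ≤ 2`, `k ∈ ℕ`, in `Ω_q`. -/
noncomputable def omegaMonomialFamily (q : ℂ) : Fin 3 × Fin 3 × ℕ → OmegaAlg q :=
  fun p => omegaMk q (genX ^ (p.1 : ℕ) * genY ^ (p.2.1 : ℕ) * genZ ^ p.2.2)

theorem mul_pow_of_mul_eq_smul {R A : Type*} [CommSemiring R] [Semiring A] [Algebra R A]
    {a b : A} {r : R} (h : b * a = r • (a * b)) (n : ℕ) :
    b * a ^ n = r ^ n • (a ^ n * b) := by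
  induction n with
  | zero => simp
  | succ n ih =>
    rw [pow_succ, ← mul_assoc, ih, smul_mul_assoc, mul_assoc, h, mul_smul_comm, smul_smul,
      pow_succ, mul_assoc]

/-- The endomorphism of the space with basis `ℕ × ℕ × ℕ` (exponents of `X`, `Y`, `Z`) modelling
left multiplication by `X`. -/
noncomputable def leftMulX : Module.End ℂ (ℕ × ℕ × ℕ →₀ ℂ) :=
  Finsupp.linearCombination ℂ fun p =>
    if p.1 < 2 then Finsupp.single (p.1 + 1, p.2.1, p.2.2) 1 else 0

/-- The endomorphism modelling left multiplication by `Y`. -/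
noncomputable def leftMulY (q : ℂ) : Module.End ℂ (ℕ × ℕ × ℕ →₀ ℂ) :=
  Finsupp.linearCombination ℂ fun p =>
    if p.2.1 < 2 then q ^ p.1 • Finsupp.single (p.1, p.2.1 + 1, p.2.2) 1 else 0

/-- The endomorphism modelling left multiplication by `Z`. -/
noncomputable def leftMulZ (q : ℂ) : Module.End ℂ (ℕ × ℕ × ℕ →₀ ℂ) :=
  Finsupp.linearCombination ℂ fun p =>
    (q ^ p.1 * q ^ (2 * p.2.1)) • Finsupp.single (p.1, p.2.1, p.2.2 + 1) 1

theorem leftMulX_single (i j k : ℕ) :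
    leftMulX (Finsupp.single (i, j, k) 1) =
      if i < 2 then Finsupp.single (i + 1, j, k) 1 else 0 := by
  simp [leftMulX]

theorem leftMulY_single (q : ℂ) (i j k : ℕ) :
    leftMulY q (Finsupp.single (i, j, k) 1) =
      if j < 2 then q ^ i • Finsupp.single (i, j + 1, k) 1 else 0 := by
  simp [leftMulY]

theorem leftMulZ_single (q : ℂ) (i j k : ℕ) :
    leftMulZ q (Finsupp.single (i, j, k) 1) =
      (q ^ i * q ^ (2 * j)) • Finsupp.single (i, j, k + 1) 1 := by
  simp [leftMulZ]

theorem end_ext_single {f g : Module.End ℂ (ℕ × ℕ × ℕ →₀ ℂ)}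
    (h : ∀ i j k, f (Finsupp.single (i, j, k) 1) = g (Finsupp.single (i, j, k) 1)) : f = g :=
  Finsupp.lhom_ext' fun ⟨i, j, k⟩ => LinearMap.ext_ring (h i j k)

/-- The representation of the free algebra sending the generators to the model endomorphisms. -/
noncomputable def freeRep (q : ℂ) :
    FreeAlgebra ℂ (Fin 3) →ₐ[ℂ] Module.End ℂ (ℕ × ℕ × ℕ →₀ ℂ) :=
  FreeAlgebra.lift ℂ ![leftMulX, leftMulY q, leftMulZ q]

@[simp] theorem freeRep_genX (q : ℂ) : freeRep q genX = leftMulX := by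
  simp [freeRep, genX]

@[simp] theorem freeRep_genY (q : ℂ) : freeRep q genY = leftMulY q := by
  simp [freeRep, genY]

@[simp] theorem freeRep_genZ (q : ℂ) : freeRep q genZ = leftMulZ q := by
  simp [freeRep, genZ]

theorem freeRep_eq_of_rel (q : ℂ) ⦃a b : FreeAlgebra ℂ (Fin 3)⦄ (h : OmegaRel q a b) :
    freeRep q a = freeRep q b := by
  cases h <;> refine end_ext_single fun i j k => ?_ <;>
    simp only [map_mul, map_smul, map_zero, freeRep_genX, freeRep_genY, freeRep_genZ,
      pow_three, Module.End.mul_apply, LinearMap.smul_apply, LinearMap.zero_apply]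
  · simp only [leftMulX_single]
    split_ifs <;> simp only [map_zero, leftMulX_single]
    split_ifs <;> simp only [map_zero, leftMulX_single]
    split_ifs <;> first | rfl | omega
  · by_cases hi : i < 2 <;> by_cases hj : j < 2 <;>
      simp only [leftMulX_single, leftMulY_single, hi, hj, if_true, if_false, map_smul, map_zero,
        smul_zero, smul_smul, pow_succ']
  · by_cases hi : i < 2 <;>
      simp only [leftMulX_single, leftMulZ_single, hi, if_true, if_false, map_smul, map_zero,
        smul_zero, smul_smul, pow_succ', mul_assoc]
  · simp only [leftMulY_single]
    split_ifs <;> simp only [map_zero, map_smul, leftMulY_single]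
    split_ifs <;> simp only [map_zero, map_smul, smul_zero, leftMulY_single]
    split_ifs <;> first | omega | simp only [smul_zero]
  · by_cases hj : j < 2 <;>
      simp only [leftMulY_single, leftMulZ_single, hj, if_true, if_false, map_smul, map_zero,
        smul_zero, smul_smul]
    congr 1
    ring

/-- The representation of `Ω_q` on the space with basis `ℕ × ℕ × ℕ`. -/
noncomputable def omegaRep (q : ℂ) : OmegaAlg q →ₐ[ℂ] Module.End ℂ (ℕ × ℕ × ℕ →₀ ℂ) :=
  RingQuot.liftAlgHom ℂ ⟨freeRep q, freeRep_eq_of_rel q⟩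

theorem omegaRep_omegaMk (q : ℂ) (a : FreeAlgebra ℂ (Fin 3)) :
    omegaRep q (omegaMk q a) = freeRep q a :=
  RingQuot.liftAlgHom_mkAlgHom_apply _ _ _ _

theorem leftMulZ_pow_single (q : ℂ) (k : ℕ) :
    (leftMulZ q ^ k) (Finsupp.single (0, 0, 0) 1) = Finsupp.single (0, 0, k) 1 := by
  induction k with
  | zero => simp
  | succ k ih => rw [pow_succ', Module.End.mul_apply, ih, leftMulZ_single]; simp

theorem leftMulY_pow_single (q : ℂ) {j : ℕ} (hj : j ≤ 2) (k : ℕ) :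
    (leftMulY q ^ j) (Finsupp.single (0, 0, k) 1) = Finsupp.single (0, j, k) 1 := by
  induction j with
  | zero => simp
  | succ j ih =>
    rw [pow_succ', Module.End.mul_apply, ih (by omega), leftMulY_single, if_pos (by omega)]
    simp

theorem leftMulX_pow_single {i : ℕ} (hi : i ≤ 2) (j k : ℕ) :
    (leftMulX ^ i) (Finsupp.single (0, j, k) 1) = Finsupp.single (i, j, k) 1 := by
  induction i with
  | zero => simp
  | succ i ih =>
    rw [pow_succ', Module.End.mul_apply, ih (by omega), leftMulX_single, if_pos (by omega)]

theorem omegaRep_monomial_apply (q : ℂ) (p : Fin 3 × Fin 3 × ℕ) :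
    omegaRep q (omegaMonomialFamily q p) (Finsupp.single (0, 0, 0) 1) =
      Finsupp.single ((p.1 : ℕ), (p.2.1 : ℕ), p.2.2) 1 := by
  rw [omegaMonomialFamily, omegaRep_omegaMk]
  simp only [map_mul, map_pow, freeRep_genX, freeRep_genY, freeRep_genZ, Module.End.mul_apply]
  rw [leftMulZ_pow_single, leftMulY_pow_single q (by omega), leftMulX_pow_single (by omega)]

theorem linearIndependent_omegaMonomialFamily (q : ℂ) :
    LinearIndependent ℂ (omegaMonomialFamily q) := by
  refine LinearIndependent.of_comp
    ((LinearMap.applyₗ (Finsupp.single (0, 0, 0) 1)).comp (omegaRep q).toLinearMap) ?_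
  have hinj : Function.Injective
      fun p : Fin 3 × Fin 3 × ℕ => ((p.1 : ℕ), (p.2.1 : ℕ), p.2.2) := by
    rintro ⟨i, j, k⟩ ⟨i', j', k'⟩ h
    simpa [Fin.ext_iff] using h
  convert (Finsupp.basisSingleOne (R := ℂ)).linearIndependent.comp _ hinj using 1
  funext p
  simpa using omegaRep_monomial_apply q p

section Relations

variable (q : ℂ)

theorem omegaMk_eq_of_rel {a b : FreeAlgebra ℂ (Fin 3)} (h : OmegaRel q a b) :
    omegaMk q a = omegaMk q b :=
  RingQuot.mkAlgHom_rel ℂ h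

theorem omegaMk_genX_pow_three : omegaMk q genX ^ 3 = 0 := by
  simpa using omegaMk_eq_of_rel q OmegaRel.x3

theorem omegaMk_genY_pow_three : omegaMk q genY ^ 3 = 0 := by
  simpa using omegaMk_eq_of_rel q OmegaRel.y3

theorem omegaMk_genY_mul_genX :
    omegaMk q genY * omegaMk q genX = q • (omegaMk q genX * omegaMk q genY) := by
  simpa using omegaMk_eq_of_rel q OmegaRel.yx

theorem omegaMk_genZ_mul_genX :
    omegaMk q genZ * omegaMk q genX = q • (omegaMk q genX * omegaMk q genZ) := by
  simpa using omegaMk_eq_of_rel q OmegaRel.zx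

theorem omegaMk_genZ_mul_genY :
    omegaMk q genZ * omegaMk q genY = q ^ 2 • (omegaMk q genY * omegaMk q genZ) := by
  simpa using omegaMk_eq_of_rel q OmegaRel.zy

theorem omegaMonomial_mem_span (i j k : ℕ) :
    omegaMk q genX ^ i * omegaMk q genY ^ j * omegaMk q genZ ^ k ∈
      Submodule.span ℂ (Set.range (omegaMonomialFamily q)) := by
  by_cases hi : i < 3
  · by_cases hj : j < 3
    · refine Submodule.subset_span ⟨(⟨i, hi⟩, ⟨j, hj⟩, k), ?_⟩
      simp [omegaMonomialFamily]
    · simp [pow_eq_zero_of_le (not_lt.1 hj) (omegaMk_genY_pow_three q)]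
  · simp [pow_eq_zero_of_le (not_lt.1 hi) (omegaMk_genX_pow_three q)]

theorem omegaMk_ι_mul_monomial_mem_span (n : Fin 3) (i j k : ℕ) :
    omegaMk q (FreeAlgebra.ι ℂ n) *
        (omegaMk q genX ^ i * omegaMk q genY ^ j * omegaMk q genZ ^ k) ∈
      Submodule.span ℂ (Set.range (omegaMonomialFamily q)) := by
  fin_cases n
  · change omegaMk q genX * _ ∈ _
    rw [← mul_assoc, ← mul_assoc, ← pow_succ']
    exact omegaMonomial_mem_span q (i + 1) j k
  · change omegaMk q genY * _ ∈ _
    rw [← mul_assoc, ← mul_assoc, mul_pow_of_mul_eq_smul (omegaMk_genY_mul_genX q),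
      smul_mul_assoc, smul_mul_assoc, mul_assoc (_ ^ i), ← pow_succ']
    exact Submodule.smul_mem _ _ (omegaMonomial_mem_span q i (j + 1) k)
  · change omegaMk q genZ * _ ∈ _
    rw [← mul_assoc, ← mul_assoc, mul_pow_of_mul_eq_smul (omegaMk_genZ_mul_genX q),
      smul_mul_assoc, smul_mul_assoc, mul_assoc (_ ^ i),
      mul_pow_of_mul_eq_smul (omegaMk_genZ_mul_genY q), mul_smul_comm, smul_mul_assoc,
      ← mul_assoc, mul_assoc _ (omegaMk q genZ), ← pow_succ']
    exact Submodule.smul_mem _ _ (Submodule.smul_mem _ _ (omegaMonomial_mem_span q i j (k + 1)))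

theorem omegaMk_mul_mem_span (a : FreeAlgebra ℂ (Fin 3)) :
    ∀ w ∈ Submodule.span ℂ (Set.range (omegaMonomialFamily q)),
      omegaMk q a * w ∈ Submodule.span ℂ (Set.range (omegaMonomialFamily q)) := by
  induction a using FreeAlgebra.induction with
  | grade0 r =>
    intro w hw
    rw [AlgHom.commutes, ← Algebra.smul_def]
    exact Submodule.smul_mem _ _ hw
  | grade1 n =>
    intro w hw
    induction hw using Submodule.span_induction with
    | mem w hw =>
      obtain ⟨p, rfl⟩ := hw
      simpa [omegaMonomialFamily] using omegaMk_ι_mul_monomial_mem_span q n p.1 p.2.1 p.2.2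
    | zero => simp
    | add v w _ _ hv hw => rw [mul_add]; exact Submodule.add_mem _ hv hw
    | smul c w _ hw => rw [mul_smul_comm]; exact Submodule.smul_mem _ _ hw
  | mul a b ha hb =>
    intro w hw
    rw [map_mul, mul_assoc]
    exact ha _ (hb _ hw)
  | add a b ha hb =>
    intro w hw
    rw [map_add, add_mul]
    exact Submodule.add_mem _ (ha _ hw) (hb _ hw)

theorem span_omegaMonomialFamily :
    Submodule.span ℂ (Set.range (omegaMonomialFamily q)) = ⊤ := by
  refine eq_top_iff.2 fun w _ => ?_
  obtain ⟨a, rfl⟩ := RingQuot.mkAlgHom_surjective ℂ (OmegaRel q) w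
  change omegaMk q a ∈ _
  simpa using omegaMk_mul_mem_span q a _ (omegaMonomial_mem_span q 0 0 0)

end Relations

/-- For `q` a primitive cube root of unity, the images of the monomials
`X^i Y^j Z^k` with `0 ≤ i ≤ 2`, `0 ≤ j ≤ 2`, `k ∈ ℕ` form a ℂ-vector space basis of `Ω_q`
(they are linearly independent and span); in particular the relations are consistent,
i.e. `Ω_q ≠ 0`. -/
theorem omega_monomial_basis (q : ℂ) (hq3 : q ^ 3 = 1) (hq1 : q ≠ 1) :
    LinearIndependent ℂ (omegaMonomialFamily q) ∧
    Submodule.span ℂ (Set.range (omegaMonomialFamily q)) = ⊤ ∧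
    (1 : OmegaAlg q) ≠ 0 := by
  have hli := linearIndependent_omegaMonomialFamily q
  refine ⟨hli, span_omegaMonomialFamily q, ?_⟩
  simpa [omegaMonomialFamily] using hli.ne_zero (0, 0, 0)
end
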